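/- Estimate from the wave coordinate condition (Lemma 12.1): there is a universal constant C such that the following holds. Let g = (g_{αβ}) be a smooth field of symmetric invertible 4×4 matrices on an open subset of ℝ^{1+3}, with inverse g^{αβ}, satisfying the wave coordinate condition ∂_μ ( g^{μν} √|det g| ) = 0 for ν = 0,…,3, and suppose H^{αβ} = g^{αβ} − m^{αβ} satisfies |H| ≤ 1/4 pointwise. Then at every point with x ≠ 0, |∂H|_{L𝒯} ≤ C ( |∂̄H| + |H| |∂H| ) and |∂ (t̄r H)| ≤ C ( |∂̄H| + |H| |∂H| ), where t̄r H = H_{LL̄} + m^{αβ}H_{αβ} = δ^{AB}H_{AB} is the tangential trace. -/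

import Mathlib

open scoped BigOperators ENNReal
open MeasureTheory

noncomputable section

namespace LindbladRodnianski

/-- Minkowski metric `diag(-1,1,1,1)` (numerically the same with indices up or down). -/
def mink (α β : Fin 4) : ℝ := if α = β then (if α = 0 then -1 else 1) else 0

/-- spatial part of a spacetime point -/
def sp (y : Fin 4 → ℝ) : Fin 3 → ℝ := fun i => y i.succ

/-- Euclidean norm on `Fin 3 → ℝ` -/
def nr3 (x : Fin 3 → ℝ) : ℝ := Real.sqrt (∑ i : Fin 3, x i ^ 2)

/-- r = |x| -/
def rad (y : Fin 4 → ℝ) : ℝ := nr3 (sp y)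

/-- the unit spatial direction ω = x/|x| -/
def uom (y : Fin 4 → ℝ) : Fin 3 → ℝ := fun i => sp y i / rad y

/-- q = r - t -/
def qq (y : Fin 4 → ℝ) : ℝ := rad y - y 0

/-- combine a time and a space point into a spacetime point -/
def tins (t : ℝ) (x : Fin 3 → ℝ) : Fin 4 → ℝ := Fin.cons t x

/-- L = (1, ω) (indices up) -/
def vecL (ω : Fin 3 → ℝ) : Fin 4 → ℝ := ![1, ω 0, ω 1, ω 2]
/-- L̄ = (1, -ω) (indices up) -/
def vecLb (ω : Fin 3 → ℝ) : Fin 4 → ℝ := ![1, -ω 0, -ω 1, -ω 2]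
/-- L with index lowered by m -/
def vecLlow (ω : Fin 3 → ℝ) : Fin 4 → ℝ := ![-1, ω 0, ω 1, ω 2]
/-- L̄ with index lowered by m -/
def vecLblow (ω : Fin 3 → ℝ) : Fin 4 → ℝ := ![-1, -ω 0, -ω 1, -ω 2]
/-- a spatial vector viewed as a spacetime vector -/
def spat (s : Fin 3 → ℝ) : Fin 4 → ℝ := ![0, s 0, s 1, s 2]

/-- `ω, s₁, s₂` is an (ordered) orthonormal frame of ℝ³;
equivalently `s₁, s₂` is an orthonormal basis of the plane orthogonal to the unit vector ω. -/
def IsFrame (ω s₁ s₂ : Fin 3 → ℝ) : Prop :=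
  (∑ i : Fin 3, ω i * ω i) = 1 ∧ (∑ i : Fin 3, s₁ i * s₁ i) = 1 ∧
  (∑ i : Fin 3, s₂ i * s₂ i) = 1 ∧ (∑ i : Fin 3, s₁ i * s₂ i) = 0 ∧
  (∑ i : Fin 3, ω i * s₁ i) = 0 ∧ (∑ i : Fin 3, ω i * s₂ i) = 0

/-- contraction of a 2-tensor with two vectors: `p_{αβ} U^α V^β` -/
def con2 (p : Fin 4 → Fin 4 → ℝ) (U V : Fin 4 → ℝ) : ℝ :=
  ∑ α : Fin 4, ∑ β : Fin 4, p α β * U α * V β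

/-- Euclidean norm of a 2-tensor -/
def tnorm (p : Fin 4 → Fin 4 → ℝ) : ℝ :=
  Real.sqrt (∑ α : Fin 4, ∑ β : Fin 4, (p α β) ^ 2)

/-- coordinate derivative ∂_α f -/
def pd (f : (Fin 4 → ℝ) → ℝ) (α : Fin 4) (y : Fin 4 → ℝ) : ℝ :=
  fderiv ℝ f y (Pi.single α 1)

/-- ∂_α ∂_β f -/
def pd2 (f : (Fin 4 → ℝ) → ℝ) (α β : Fin 4) (y : Fin 4 → ℝ) : ℝ :=
  pd (pd f β) α y

/-- |∂f| -/
def dnorm (f : (Fin 4 → ℝ) → ℝ) (y : Fin 4 → ℝ) : ℝ :=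
  Real.sqrt (∑ α : Fin 4, (pd f α y) ^ 2)

/-- ω extended by ω₀ = 0 to a spacetime vector -/
def uom4 (y : Fin 4 → ℝ) : Fin 4 → ℝ := spat (uom y)

/-- radial derivative ∂_r f = ω^j ∂_j f -/
def pdr (f : (Fin 4 → ℝ) → ℝ) (y : Fin 4 → ℝ) : ℝ :=
  ∑ α : Fin 4, uom4 y α * pd f α y

/-- ∂_q = ½(∂_r - ∂_t) -/
def pdq (f : (Fin 4 → ℝ) → ℝ) (y : Fin 4 → ℝ) : ℝ := (pdr f y - pd f 0 y) / 2

/-- ∂_s = ½(∂_t + ∂_r) -/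
def pds (f : (Fin 4 → ℝ) → ℝ) (y : Fin 4 → ℝ) : ℝ := (pd f 0 y + pdr f y) / 2

/-- the tangential derivatives: index 0 is ∂_s, index i.succ is ∂̄_i = ∂_i - ω_i ω^j ∂_j -/
def tpd (f : (Fin 4 → ℝ) → ℝ) (a : Fin 4) (y : Fin 4 → ℝ) : ℝ :=
  if a = 0 then pds f y else pd f a y - uom4 y a * pdr f y

/-- |∂̄f| -/
def tdnorm (f : (Fin 4 → ℝ) → ℝ) (y : Fin 4 → ℝ) : ℝ :=
  Real.sqrt (∑ a : Fin 4, (tpd f a y) ^ 2)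

/-- coordinates with the index lowered: x₀ = -t, x_i = xⁱ -/
def lowerc (y : Fin 4 → ℝ) (α : Fin 4) : ℝ := if α = 0 then -(y 0) else y α

/-- the translation vector field ∂_μ (its coefficients) -/
def dVF (μ : Fin 4) : (Fin 4 → ℝ) → Fin 4 → ℝ := fun _ => Pi.single μ 1

/-- the rotation/boost field Ω_{ab} = x_a ∂_b - x_b ∂_a (its coefficients) -/
def omVF (a b : Fin 4) : (Fin 4 → ℝ) → Fin 4 → ℝ :=
  fun y ν => lowerc y a * (if ν = b then (1:ℝ) else 0) - lowerc y b * (if ν = a then (1:ℝ) else 0)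

/-- the scaling field S = t∂_t + x^i∂_i (its coefficients) -/
def sVF : (Fin 4 → ℝ) → Fin 4 → ℝ := fun y => y

/-- the family 𝒵 of Minkowski vector fields -/
def ZV : Fin 11 → (Fin 4 → ℝ) → Fin 4 → ℝ :=
  ![dVF 0, dVF 1, dVF 2, dVF 3,
    omVF 0 1, omVF 0 2, omVF 0 3, omVF 1 2, omVF 1 3, omVF 2 3, sVF]

/-- apply a vector field (given by its coefficients) to a function -/
def Zap (Zc : (Fin 4 → ℝ) → Fin 4 → ℝ) (f : (Fin 4 → ℝ) → ℝ) (y : Fin 4 → ℝ) : ℝ :=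
  ∑ μ : Fin 4, Zc y μ * pd f μ y

/-- the Minkowski wave operator □ = m^{αβ}∂_α∂_β = -∂_t² + Δ -/
def box (f : (Fin 4 → ℝ) → ℝ) (y : Fin 4 → ℝ) : ℝ :=
  ∑ α : Fin 4, ∑ β : Fin 4, mink α β * pd2 f α β y

/-- the reduced wave operator □̃_g = □ + H^{αβ}∂_α∂_β with g = m + H (indices up) -/
def boxg (H : (Fin 4 → ℝ) → Fin 4 → Fin 4 → ℝ) (f : (Fin 4 → ℝ) → ℝ) (y : Fin 4 → ℝ) : ℝ :=
  box f y + ∑ α : Fin 4, ∑ β : Fin 4, H y α β * pd2 f α β y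

/-- |k|_{L𝒯} for an index-up 2-tensor (contractions with lowered frame vectors) -/
def normLT (k : Fin 4 → Fin 4 → ℝ) (ω s₁ s₂ : Fin 3 → ℝ) : ℝ :=
  |con2 k (vecLlow ω) (vecLlow ω)| + |con2 k (vecLlow ω) (spat s₁)| +
    |con2 k (vecLlow ω) (spat s₂)|

/-- the region D_t = {x : t/2 ≤ |x| ≤ 2t} -/
def Dreg (t : ℝ) : Set (Fin 3 → ℝ) := {x | t / 2 ≤ nr3 x ∧ nr3 x ≤ 2 * t}


/-- the family 𝒰 = {L, L̄, S₁, S₂} (indices up) -/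
def Ufam (ω s₁ s₂ : Fin 3 → ℝ) : Fin 4 → Fin 4 → ℝ := ![vecL ω, vecLb ω, spat s₁, spat s₂]

/-- the family 𝒯 = {L, S₁, S₂} with the index lowered by m -/
def TfamLow (ω s₁ s₂ : Fin 3 → ℝ) : Fin 3 → Fin 4 → ℝ := ![vecLlow ω, spat s₁, spat s₂]

/-- |∂H|: Euclidean norm of all first derivatives of all components of H -/
def dHnorm (H : (Fin 4 → ℝ) → Fin 4 → Fin 4 → ℝ) (y : Fin 4 → ℝ) : ℝ :=
  Real.sqrt (∑ γ : Fin 4, ∑ α : Fin 4, ∑ β : Fin 4, (pd (fun z => H z α β) γ y) ^ 2)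

/-- |∂̄H|: Euclidean norm of all tangential derivatives of all components of H -/
def tdHnorm (H : (Fin 4 → ℝ) → Fin 4 → Fin 4 → ℝ) (y : Fin 4 → ℝ) : ℝ :=
  Real.sqrt (∑ a : Fin 4, ∑ α : Fin 4, ∑ β : Fin 4, (tpd (fun z => H z α β) a y) ^ 2)

/-- |∂H|_{L𝒯} = Σ_{U∈𝒰, T∈𝒯} |U^γ L_α T_β ∂_γ H^{αβ}| -/
def dHLT (H : (Fin 4 → ℝ) → Fin 4 → Fin 4 → ℝ) (ω s₁ s₂ : Fin 3 → ℝ) (y : Fin 4 → ℝ) : ℝ :=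
  ∑ u : Fin 4, ∑ t' : Fin 3,
    |∑ γ : Fin 4, ∑ α : Fin 4, ∑ β : Fin 4,
        Ufam ω s₁ s₂ u γ * vecLlow ω α * TfamLow ω s₁ s₂ t' β * pd (fun z => H z α β) γ y|

/-- |∂(t̄r H)| where t̄r H = H_{LL̄} + m_{αβ}H^{αβ}, the derivative being taken
 of the components of H before contracting with the (pointwise) null frame. -/
def dtrbar (H : (Fin 4 → ℝ) → Fin 4 → Fin 4 → ℝ) (ω : Fin 3 → ℝ) (y : Fin 4 → ℝ) : ℝ :=
  Real.sqrt (∑ γ : Fin 4,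
    (∑ α : Fin 4, ∑ β : Fin 4,
        (vecLlow ω α * vecLblow ω β + mink α β) * pd (fun z => H z α β) γ y) ^ 2)

/-- **Jacobi's formula** for the derivative of the determinant. -/
theorem hasFDerivAt_matrix_det {E n : Type*} [NormedAddCommGroup E] [NormedSpace ℝ E]
    [Fintype n] [DecidableEq n] {A : E → n → n → ℝ} {A' : n → n → E →L[ℝ] ℝ} {x : E}
    (hA : ∀ i j, HasFDerivAt (fun z => A z i j) (A' i j) x) :
    HasFDerivAt (fun z => (Matrix.of (A z)).det)
      (∑ i, ∑ j, (Matrix.of (A x)).adjugate j i • A' i j) x := by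
  let D : ContinuousMultilinearMap ℝ (fun _ : n => n → ℝ) ℝ :=
    { toMultilinearMap :=
        (Matrix.detRowAlternating : (n → ℝ) [⋀^n]→ₗ[ℝ] ℝ).toMultilinearMap
      cont := Continuous.matrix_det (A := fun M : n → n → ℝ => Matrix.of M) continuous_id }
  have h : HasFDerivAt A (ContinuousLinearMap.pi fun i => ContinuousLinearMap.pi fun j => A' i j)
      x := hasFDerivAt_pi.2 fun i => hasFDerivAt_pi.2 fun j => hA i j
  refine ((D.hasFDerivAt (A x)).comp x h).congr_fderiv ?_
  ext v
  simp only [ContinuousLinearMap.comp_apply, ContinuousMultilinearMap.linearDeriv_apply,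
    _root_.sum_apply, _root_.smul_apply, smul_eq_mul]
  refine Finset.sum_congr rfl fun i _ => ?_
  change ((Matrix.of (A x)).updateRow i (fun j => A' i j v)).det = _
  rw [← Matrix.cramer_transpose_apply, Matrix.cramer_eq_adjugate_mulVec,
    ← Matrix.adjugate_transpose]
  rfl

/-- In any number of dimensions, `∂(√|det A⁻¹|) = -½ √|det A⁻¹| tr (A⁻¹ ∂A)`. -/
theorem hasFDerivAt_sqrt_abs_det_of_mul_eq_one {E n : Type*} [NormedAddCommGroup E]
    [NormedSpace ℝ E] [Fintype n] [DecidableEq n] {A B : E → n → n → ℝ}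
    {A' : n → n → E →L[ℝ] ℝ} {x : E}
    (hA : ∀ i j, HasFDerivAt (fun z => A z i j) (A' i j) x)
    (hBA : ∀ᶠ z in nhds x, Matrix.of (B z) * Matrix.of (A z) = 1) :
    HasFDerivAt (fun z => Real.sqrt |(Matrix.of (B z)).det|)
      ((-(1 / 2) * Real.sqrt |(Matrix.of (B x)).det|) • ∑ i, ∑ j, B x j i • A' i j) x := by
  have hdet : ∀ z, Matrix.of (B z) * Matrix.of (A z) = 1 →
      (Matrix.of (B z)).det * (Matrix.of (A z)).det = 1 := fun z hz => by
    rw [← Matrix.det_mul, hz, Matrix.det_one]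
  have hexp : ∀ z, Matrix.of (B z) * Matrix.of (A z) = 1 →
      Real.sqrt |(Matrix.of (B z)).det| = Real.exp (-(1 / 2) * Real.log (Matrix.of (A z)).det) := by
    intro z hz
    have h1 := hdet z hz
    have h0 : (Matrix.of (B z)).det ≠ 0 := left_ne_zero_of_mul_eq_one h1
    rw [Real.sqrt_eq_rpow, Real.rpow_def_of_pos (abs_pos.2 h0), Real.log_abs,
      eq_inv_of_mul_eq_one_left h1, Real.log_inv]
    ring_nf
  have hx := hBA.self_of_nhds
  have h0 : (Matrix.of (A x)).det ≠ 0 := right_ne_zero_of_mul_eq_one (hdet x hx)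
  have hadj : ∀ i j, (Matrix.of (A x)).adjugate j i = (Matrix.of (A x)).det * B x j i := by
    intro i j
    have : (Matrix.of (A x)).adjugate = (Matrix.of (A x)).det • Matrix.of (B x) := by
      calc _ = Matrix.of (B x) * Matrix.of (A x) * (Matrix.of (A x)).adjugate := by
            rw [hx, one_mul]
        _ = _ := by rw [mul_assoc, Matrix.mul_adjugate, Matrix.mul_smul, mul_one]
    rw [this]; rfl
  have hd := (((hasFDerivAt_matrix_det hA).log h0).const_mul (-(1 / 2))).exp
  refine (hd.congr_of_eventuallyEq (hBA.mono fun z hz => hexp z hz)).congr_fderiv ?_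
  rw [← hexp x hx]
  ext v
  simp only [hadj, _root_.smul_apply, _root_.sum_apply, smul_eq_mul,
    mul_assoc, ← Finset.mul_sum]
  field_simp

theorem abs_sum_fin_le {n : ℕ} {f : Fin n → ℝ} {B : ℝ} (hf : ∀ i, |f i| ≤ B) :
    |∑ i, f i| ≤ n * B :=
  (Finset.abs_sum_le_sum_abs _ _).trans <|
    (Finset.sum_le_sum fun i _ => hf i).trans_eq (by simp)

theorem abs_sum_sum_fin_le {m n : ℕ} {f : Fin m → Fin n → ℝ} {B : ℝ}
    (hf : ∀ i j, |f i j| ≤ B) : |∑ i, ∑ j, f i j| ≤ m * (n * B) :=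
  abs_sum_fin_le fun i => abs_sum_fin_le (hf i)

theorem abs_mul_le_mul {a b A B : ℝ} (ha : |a| ≤ A) (hb : |b| ≤ B) : |a * b| ≤ A * B := by
  rw [abs_mul]
  exact mul_le_mul ha hb (abs_nonneg _) ((abs_nonneg _).trans ha)

theorem abs_le_tnorm (p : Fin 4 → Fin 4 → ℝ) (α β : Fin 4) : |p α β| ≤ tnorm p := by
  refine Real.abs_le_sqrt ?_
  calc p α β ^ 2 ≤ ∑ b, p α b ^ 2 :=
        Finset.single_le_sum (f := fun b => p α b ^ 2) (fun _ _ => sq_nonneg _)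
          (Finset.mem_univ β)
    _ ≤ ∑ a, ∑ b, p a b ^ 2 :=
        Finset.single_le_sum (f := fun a => ∑ b, p a b ^ 2)
          (fun _ _ => Finset.sum_nonneg fun _ _ => sq_nonneg _) (Finset.mem_univ α)

theorem abs_le_sqrt_sum_sq (p : Fin 4 → Fin 4 → Fin 4 → ℝ) (γ α β : Fin 4) :
    |p γ α β| ≤ Real.sqrt (∑ c, ∑ a, ∑ b, p c a b ^ 2) := by
  refine (abs_le_tnorm (p γ) α β).trans (Real.sqrt_le_sqrt ?_)
  exact Finset.single_le_sum (f := fun c => ∑ a, ∑ b, p c a b ^ 2)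
    (fun _ _ => Finset.sum_nonneg fun _ _ => Finset.sum_nonneg fun _ _ => sq_nonneg _)
    (Finset.mem_univ γ)

theorem abs_mink_le_one (α β : Fin 4) : |mink α β| ≤ 1 := by
  unfold mink; split_ifs <;> norm_num

section Inverse

variable {g h : Fin 4 → Fin 4 → ℝ}

theorem eq_mink_sub_of_inverse
    (hinv : ∀ α β, ∑ γ, g α γ * (mink γ β + h γ β) = if α = β then 1 else 0) (α β : Fin 4) :
    g α β = mink α β - (∑ γ, g α γ * h γ β) * mink β β := by
  have := hinv α β
  fin_cases β <;> fin_cases α <;>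
    simp [mink, Fin.sum_univ_four, mul_add] at this ⊢ <;> linarith

theorem abs_le_two_of_inverse
    (hinv : ∀ α β, ∑ γ, g α γ * (mink γ β + h γ β) = if α = β then 1 else 0)
    (hh : tnorm h ≤ 1 / 4) (α β : Fin 4) : |g α β| ≤ 2 := by
  have hrow : ∀ β, g α β ^ 2 ≤ 2 * mink α β ^ 2 + 2 * ((∑ γ, g α γ ^ 2) * ∑ γ, h γ β ^ 2) := by
    intro β
    have hcs := Finset.sum_mul_sq_le_sq_mul_sq Finset.univ (g α) (fun γ => h γ β)
    have hm : mink β β ^ 2 = 1 := by fin_cases β <;> simp [mink]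
    have hm' : ((∑ γ, g α γ * h γ β) * mink β β) ^ 2 = (∑ γ, g α γ * h γ β) ^ 2 := by
      rw [mul_pow, hm, mul_one]
    rw [eq_mink_sub_of_inverse hinv α β]
    nlinarith [sq_nonneg (mink α β + (∑ γ, g α γ * h γ β) * mink β β)]
  have hsum := Finset.sum_le_sum fun β (_ : β ∈ Finset.univ) => hrow β
  have hsq : ∑ α, ∑ β, h α β ^ 2 ≤ (1 / 4) ^ 2 :=
    (Real.sqrt_le_left (by norm_num)).1 hh
  have hmk : ∑ β, mink α β ^ 2 = 1 := by
    fin_cases α <;> simp [mink]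
  rw [Finset.sum_add_distrib, ← Finset.mul_sum, ← Finset.mul_sum, ← Finset.mul_sum, hmk,
    Finset.sum_comm (f := fun β γ => h γ β ^ 2)] at hsum
  have hr : 0 ≤ ∑ γ, g α γ ^ 2 := Finset.sum_nonneg fun _ _ => sq_nonneg _
  have hle : g α β ^ 2 ≤ ∑ γ, g α γ ^ 2 :=
    Finset.single_le_sum (f := fun γ => g α γ ^ 2) (fun _ _ => sq_nonneg _)
      (Finset.mem_univ β)
  exact abs_le_of_sq_le_sq (by nlinarith) (by norm_num)

theorem abs_sub_mink_le_of_inverse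
    (hinv : ∀ α β, ∑ γ, g α γ * (mink γ β + h γ β) = if α = β then 1 else 0)
    (hh : tnorm h ≤ 1 / 4) (α β : Fin 4) : |g α β - mink α β| ≤ 8 * tnorm h := by
  have hs : |∑ γ, g α γ * h γ β| ≤ (4 : ℕ) * (2 * tnorm h) := abs_sum_fin_le fun γ =>
    abs_mul_le_mul (abs_le_two_of_inverse hinv hh α γ) (abs_le_tnorm h γ β)
  have := abs_mul_le_mul hs (abs_mink_le_one β β)
  rw [eq_mink_sub_of_inverse hinv α β, sub_sub_cancel_left, abs_neg]
  refine this.trans_eq ?_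
  push_cast
  ring

/-- The linearisation of the wave coordinate condition at the Minkowski metric, with a quadratic
error term. -/
theorem abs_linearized_wave_coordinate_le {G : Fin 4 → Fin 4 → Fin 4 → ℝ} {d : ℝ}
    (hinv : ∀ α β, ∑ γ, g α γ * (mink γ β + h γ β) = if α = β then 1 else 0)
    (hh : tnorm h ≤ 1 / 4) (hG : ∀ γ α β, |G γ α β| ≤ d)
    (hwave : ∀ ν, ∑ μ, G μ μ ν
      = 1 / 2 * ∑ μ, (mink μ ν + h μ ν) * ∑ α, ∑ β, g β α * G μ α β) (ν : Fin 4) :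
    |∑ μ, G μ μ ν - 1 / 2 * (mink ν ν * ∑ α, ∑ β, mink α β * G ν α β)|
      ≤ 320 * (tnorm h * d) := by
  have hmsymm : ∀ α β, mink α β = mink β α := fun α β => by
    simp only [mink, eq_comm]
    split_ifs <;> simp_all
  have hrw : ∑ μ, G μ μ ν - 1 / 2 * (mink ν ν * ∑ α, ∑ β, mink α β * G ν α β)
      = 1 / 2 * (∑ μ, h μ ν * ∑ α, ∑ β, g β α * G μ α β)
        + 1 / 2 * (mink ν ν * ∑ α, ∑ β, (g β α - mink β α) * G ν α β) := by
    have hdiag : ∀ t : Fin 4 → ℝ, ∑ μ, mink μ ν * t μ = mink ν ν * t ν := fun t =>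
      Finset.sum_eq_single ν (fun μ _ hμ => by simp [mink, hμ]) (by simp)
    rw [hwave ν]
    simp only [add_mul, sub_mul, Finset.sum_add_distrib, Finset.sum_sub_distrib, hdiag]
    simp only [hmsymm]
    ring
  have h1 : |∑ μ, h μ ν * ∑ α, ∑ β, g β α * G μ α β|
      ≤ (4 : ℕ) * (tnorm h * ((4 : ℕ) * ((4 : ℕ) * (2 * d)))) := abs_sum_fin_le fun μ =>
    abs_mul_le_mul (abs_le_tnorm h μ ν) <| abs_sum_sum_fin_le fun α β =>
      abs_mul_le_mul (abs_le_two_of_inverse hinv hh β α) (hG μ α β)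
  have h2 : |mink ν ν * ∑ α, ∑ β, (g β α - mink β α) * G ν α β|
      ≤ 1 * ((4 : ℕ) * ((4 : ℕ) * (8 * tnorm h * d))) :=
    abs_mul_le_mul (abs_mink_le_one ν ν) <| abs_sum_sum_fin_le fun α β =>
      abs_mul_le_mul (abs_sub_mink_le_of_inverse hinv hh β α) (hG ν α β)
  have hpos : 0 ≤ tnorm h * d := mul_nonneg (Real.sqrt_nonneg _) ((abs_nonneg _).trans (hG 0 0 0))
  rw [hrw]
  push_cast at h1 h2
  rw [abs_le] at h1 h2 ⊢
  constructor <;> linarith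

end Inverse

/-- If `G = -½ ℓ ⊗ b + K`, the divergence-minus-half-trace of `G` controls the component of `G`
contracted with `ℓ ⊗ T - ½ m(ℓ, T) m`, up to `K`. -/
theorem abs_contraction_le {G K : Fin 4 → Fin 4 → Fin 4 → ℝ} {b : Fin 4 → Fin 4 → ℝ}
    {l T : Fin 4 → ℝ} {e k : ℝ} (hGK : ∀ γ α β, G γ α β = -(1 / 2) * (l γ * b α β) + K γ α β)
    (hl : ∀ γ, |l γ| ≤ 1) (hT : ∀ γ, |T γ| ≤ 1) (hlT : |∑ ν, T ν * (mink ν ν * l ν)| ≤ 2)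
    (he : ∀ ν, |∑ μ, G μ μ ν - 1 / 2 * (mink ν ν * ∑ α, ∑ β, mink α β * G ν α β)| ≤ e)
    (hK : ∀ γ α β, |K γ α β| ≤ k) (γ : Fin 4) :
    |∑ α, ∑ β, (l α * T β - 1 / 2 * (∑ ν, T ν * (mink ν ν * l ν)) * mink α β) * G γ α β|
      ≤ 4 * e + 80 * k := by
  set c := ∑ ν, T ν * (mink ν ν * l ν) with hc
  set w : Fin 4 → Fin 4 → ℝ := fun α β => l α * T β - 1 / 2 * c * mink α β with hw
  set E : Fin 4 → ℝ := fun ν => ∑ μ, G μ μ ν - 1 / 2 * (mink ν ν * ∑ α, ∑ β, mink α β * G ν α β)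
    with hE
  set q : Fin 4 → ℝ := fun ν => ∑ μ, K μ μ ν - 1 / 2 * (mink ν ν * ∑ α, ∑ β, mink α β * K ν α β)
    with hq
  have hEq : ∀ ν, E ν = -(1 / 2) * ∑ μ, l μ * b μ ν
      + 1 / 4 * (mink ν ν * l ν * ∑ α, ∑ β, mink α β * b α β) + q ν := by
    intro ν
    simp only [hE, hq, hGK, Finset.sum_add_distrib, mul_add, Finset.mul_sum]
    rw [show (∑ α, ∑ β, 1 / 4 * (mink ν ν * l ν * (mink α β * b α β)))
        = -∑ α, ∑ β, 1 / 2 * (mink ν ν * (mink α β * (-(1 / 2) * (l ν * b α β)))) by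
      simp only [← Finset.sum_neg_distrib]
      exact Finset.sum_congr rfl fun α _ => Finset.sum_congr rfl fun β _ => by ring]
    ring
  have hwb : ∑ α, ∑ β, w α β * b α β = -2 * ∑ ν, T ν * (E ν - q ν) := by
    have h1 : ∀ ν, T ν * (E ν - q ν) = -(1 / 2) * ∑ μ, l μ * T ν * b μ ν
        + 1 / 4 * (T ν * (mink ν ν * l ν)) * ∑ α, ∑ β, mink α β * b α β := by
      intro ν
      rw [hEq, show ∑ μ, l μ * T ν * b μ ν = T ν * ∑ μ, l μ * b μ ν by
        rw [Finset.mul_sum]; exact Finset.sum_congr rfl fun _ _ => by ring]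
      ring
    simp only [h1, hw, sub_mul, Finset.sum_add_distrib, Finset.sum_sub_distrib, ← Finset.mul_sum,
      ← Finset.sum_mul, mul_assoc (1 / 2 * c), ← hc]
    rw [Finset.sum_comm (f := fun ν μ => l μ * T ν * b μ ν)]
    ring
  have hqk : ∀ ν, |q ν| ≤ 12 * k := by
    intro ν
    have h1 : |∑ μ, K μ μ ν| ≤ (4 : ℕ) * k := abs_sum_fin_le fun μ => hK μ μ ν
    have h2 : |mink ν ν * ∑ α, ∑ β, mink α β * K ν α β|
        ≤ 1 * ((4 : ℕ) * ((4 : ℕ) * (1 * k))) :=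
      abs_mul_le_mul (abs_mink_le_one ν ν) <| abs_sum_sum_fin_le fun α β =>
        abs_mul_le_mul (abs_mink_le_one α β) (hK ν α β)
    push_cast at h1 h2
    simp only [hq]
    rw [abs_le] at h1 h2 ⊢
    constructor <;> linarith
  have hTE : |∑ ν, T ν * (E ν - q ν)| ≤ (4 : ℕ) * (1 * (e + 12 * k)) := abs_sum_fin_le fun ν =>
    abs_mul_le_mul (hT ν) ((abs_sub _ _).trans (add_le_add (he ν) (hqk ν)))
  have hw2 : ∀ α β, |w α β| ≤ 2 := by
    intro α β
    have h1 := abs_mul_le_mul (hl α) (hT β)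
    have h2 := abs_mul_le_mul hlT (abs_mink_le_one α β)
    simp only [hw]
    rw [abs_le] at h1 h2 ⊢
    constructor <;> linarith
  have hwK : |∑ α, ∑ β, w α β * K γ α β| ≤ (4 : ℕ) * ((4 : ℕ) * (2 * k)) :=
    abs_sum_sum_fin_le fun α β => abs_mul_le_mul (hw2 α β) (hK γ α β)
  have hfin : ∑ α, ∑ β, w α β * G γ α β
      = l γ * ∑ ν, T ν * (E ν - q ν) + ∑ α, ∑ β, w α β * K γ α β := by
    have h1 : ∑ α, ∑ β, w α β * G γ α β
        = -(1 / 2) * l γ * (∑ α, ∑ β, w α β * b α β) + ∑ α, ∑ β, w α β * K γ α β := by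
      simp only [Finset.mul_sum, ← Finset.sum_add_distrib]
      exact Finset.sum_congr rfl fun α _ => Finset.sum_congr rfl fun β _ => by rw [hGK]; ring
    rw [h1, hwb]
    ring
  have hlE := abs_mul_le_mul (hl γ) hTE
  push_cast at hlE hwK
  rw [hfin]
  rw [abs_le] at hlE hwK ⊢
  constructor <;> linarith

theorem pd_sub_const (f : (Fin 4 → ℝ) → ℝ) (c : ℝ) (γ : Fin 4) (y : Fin 4 → ℝ) :
    pd (fun z => f z - c) γ y = pd f γ y := by
  simp only [pd, fderiv_sub_const]

/-- Every derivative is an `L̄` derivative along `L` up to tangential derivatives. -/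
theorem pd_eq_neg_half_vecLlow_mul_add (f : (Fin 4 → ℝ) → ℝ) (γ : Fin 4) (y : Fin 4 → ℝ) :
    pd f γ y = -(1 / 2) * (vecLlow (uom y) γ * (pd f 0 y - pdr f y))
      + (tpd f γ y + uom4 y γ * tpd f 0 y) := by
  fin_cases γ <;> simp [vecLlow, tpd, pds, uom4, spat] <;> ring

/-- The wave coordinate condition expressed through derivatives of the inverse metric alone. -/
theorem sum_pd_eq_of_wave_coordinates {U : Set (Fin 4 → ℝ)} (hU : IsOpen U)
    {g ginv : (Fin 4 → ℝ) → Fin 4 → Fin 4 → ℝ}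
    (hsmooth : ∀ α β, ContDiffOn ℝ (⊤ : ℕ∞) (fun y => ginv y α β) U)
    (hinv : ∀ y ∈ U, ∀ α β : Fin 4,
      (∑ γ : Fin 4, g y α γ * ginv y γ β) = if α = β then 1 else 0)
    {y : Fin 4 → ℝ} (hy : y ∈ U) {ν : Fin 4}
    (hwave : (∑ μ : Fin 4,
      pd (fun z => ginv z μ ν * Real.sqrt |(Matrix.of (g z)).det|) μ y) = 0) :
    ∑ μ, pd (fun z => ginv z μ ν) μ y
      = 1 / 2 * ∑ μ, ginv y μ ν * ∑ α, ∑ β, g y β α * pd (fun z => ginv z α β) μ y := by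
  have hmul : ∀ z ∈ U, Matrix.of (g z) * Matrix.of (ginv z) = 1 := fun z hz => by
    ext α β
    simpa [Matrix.mul_apply, Matrix.one_apply] using hinv z hz α β
  have hd : ∀ α β, HasFDerivAt (fun z => ginv z α β) (fderiv ℝ (fun z => ginv z α β) y) y :=
    fun α β => (((hsmooth α β).contDiffAt (hU.mem_nhds hy)).differentiableAt
      (by simp)).hasFDerivAt
  have hw := hasFDerivAt_sqrt_abs_det_of_mul_eq_one hd
    (Filter.eventually_of_mem (hU.mem_nhds hy) hmul)
  set w := Real.sqrt |(Matrix.of (g y)).det| with hwdef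
  have hw0 : w ≠ 0 := by
    refine (Real.sqrt_pos.2 (abs_pos.2 fun h0 => ?_)).ne'
    have := congrArg Matrix.det (hmul y hy)
    simp [Matrix.det_mul, h0] at this
  have hpd : ∀ μ, pd (fun z => ginv z μ ν * Real.sqrt |(Matrix.of (g z)).det|) μ y
      = w * (pd (fun z => ginv z μ ν) μ y
        - 1 / 2 * (ginv y μ ν * ∑ α, ∑ β, g y β α * pd (fun z => ginv z α β) μ y)) := by
    intro μ
    rw [pd, ((hd μ ν).fun_mul hw).fderiv]
    simp only [_root_.add_apply, _root_.smul_apply, _root_.sum_apply, smul_eq_mul, ← hwdef, pd]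
    ring
  simp only [hpd, ← Finset.mul_sum] at hwave
  have h0 := (mul_eq_zero.1 hwave).resolve_left hw0
  rw [Finset.sum_sub_distrib, ← Finset.mul_sum] at h0
  linarith

theorem abs_le_one_of_sum_mul_self_eq_one {s : Fin 3 → ℝ} (hs : ∑ i, s i * s i = 1) (i : Fin 3) :
    |s i| ≤ 1 := by
  have : s i * s i ≤ 1 := hs ▸ Finset.single_le_sum (f := fun i => s i * s i)
    (fun i _ => mul_self_nonneg (s i)) (Finset.mem_univ i)
  exact abs_le_of_sq_le_sq (by nlinarith) zero_le_one

theorem abs_spat_le_one {s : Fin 3 → ℝ} (hs : ∀ i, |s i| ≤ 1) (γ : Fin 4) : |spat s γ| ≤ 1 := by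
  fin_cases γ <;> simp [spat, hs]

theorem abs_vecLlow_le_one {ω : Fin 3 → ℝ} (hω : ∀ i, |ω i| ≤ 1) (γ : Fin 4) :
    |vecLlow ω γ| ≤ 1 := by
  fin_cases γ <;> simp [vecLlow, hω]

theorem abs_vecLblow_le_one {ω : Fin 3 → ℝ} (hω : ∀ i, |ω i| ≤ 1) (γ : Fin 4) :
    |vecLblow ω γ| ≤ 1 := by
  fin_cases γ <;> simp [vecLblow, hω]

theorem abs_Ufam_le_one {ω s₁ s₂ : Fin 3 → ℝ} (hω : ∀ i, |ω i| ≤ 1) (h₁ : ∀ i, |s₁ i| ≤ 1)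
    (h₂ : ∀ i, |s₂ i| ≤ 1) (u γ : Fin 4) : |Ufam ω s₁ s₂ u γ| ≤ 1 := by
  fin_cases u <;> fin_cases γ <;> simp [Ufam, vecL, vecLb, spat, hω, h₁, h₂]

theorem abs_TfamLow_le_one {ω s₁ s₂ : Fin 3 → ℝ} (hω : ∀ i, |ω i| ≤ 1) (h₁ : ∀ i, |s₁ i| ≤ 1)
    (h₂ : ∀ i, |s₂ i| ≤ 1) (t : Fin 3) (γ : Fin 4) : |TfamLow ω s₁ s₂ t γ| ≤ 1 := by
  fin_cases t
  · exact abs_vecLlow_le_one hω γ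
  · exact abs_spat_le_one h₁ γ
  · exact abs_spat_le_one h₂ γ

theorem sum_TfamLow_mul_vecLlow {ω s₁ s₂ : Fin 3 → ℝ} (hF : IsFrame ω s₁ s₂) (t : Fin 3) :
    ∑ ν, TfamLow ω s₁ s₂ t ν * (mink ν ν * vecLlow ω ν) = 0 := by
  obtain ⟨h0, -, -, -, h4, h5⟩ := hF
  simp only [Fin.sum_univ_three] at h0 h4 h5
  fin_cases t <;> simp [TfamLow, vecLlow, spat, mink, Fin.sum_univ_four] <;> linarith

theorem sum_vecLblow_mul_vecLlow {ω : Fin 3 → ℝ} (hω : ∑ i, ω i * ω i = 1) :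
    ∑ ν, vecLblow ω ν * (mink ν ν * vecLlow ω ν) = -2 := by
  simp only [Fin.sum_univ_three] at hω
  simp [vecLblow, vecLlow, mink, Fin.sum_univ_four]
  linarith

/-- Lemma 12.1: estimates from the wave coordinate condition. -/
theorem wave_coordinate_condition_estimate :
    ∃ C : ℝ, 0 < C ∧
      ∀ (U : Set (Fin 4 → ℝ)), IsOpen U →
      ∀ (g ginv : (Fin 4 → ℝ) → Fin 4 → Fin 4 → ℝ),
        (∀ α β, ContDiffOn ℝ (⊤ : ℕ∞) (fun y => g y α β) U) →
        (∀ α β, ContDiffOn ℝ (⊤ : ℕ∞) (fun y => ginv y α β) U) →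
        (∀ y ∈ U, ∀ α β, g y α β = g y β α) →
        -- ginv is the inverse of g on U
        (∀ y ∈ U, ∀ α β : Fin 4,
          (∑ γ : Fin 4, g y α γ * ginv y γ β) = if α = β then 1 else 0) →
        -- the wave coordinate condition ∂_μ (g^{μν} √|det g|) = 0 on U
        (∀ ν : Fin 4, ∀ y ∈ U,
          (∑ μ : Fin 4,
            pd (fun z => ginv z μ ν * Real.sqrt |(Matrix.of (g z)).det|) μ y) = 0) →
        -- |H| ≤ 1/4 on U, where H = g⁻¹ - m⁻¹
        (∀ y ∈ U, tnorm (fun α β => ginv y α β - mink α β) ≤ 1/4) →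
        ∀ y ∈ U, sp y ≠ 0 → ∀ s₁ s₂ : Fin 3 → ℝ, IsFrame (uom y) s₁ s₂ →
          (dHLT (fun z α β => ginv z α β - mink α β) (uom y) s₁ s₂ y
              ≤ C * (tdHnorm (fun z α β => ginv z α β - mink α β) y
                + tnorm (fun α β => ginv y α β - mink α β)
                  * dHnorm (fun z α β => ginv z α β - mink α β) y)) ∧
          (dtrbar (fun z α β => ginv z α β - mink α β) (uom y) y
              ≤ C * (tdHnorm (fun z α β => ginv z α β - mink α β) y
                + tnorm (fun α β => ginv y α β - mink α β)
                  * dHnorm (fun z α β => ginv z α β - mink α β) y)) := by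
  refine ⟨61440, by norm_num, ?_⟩
  intro U hU g ginv _ hsmooth _ hinv hwave hsmall y hy _ s₁ s₂ hF
  have hω : ∀ i, |uom y i| ≤ 1 := abs_le_one_of_sum_mul_self_eq_one hF.1
  have h₁ : ∀ i, |s₁ i| ≤ 1 := abs_le_one_of_sum_mul_self_eq_one hF.2.1
  have h₂ : ∀ i, |s₂ i| ≤ 1 := abs_le_one_of_sum_mul_self_eq_one hF.2.2.1
  set H : (Fin 4 → ℝ) → Fin 4 → Fin 4 → ℝ := fun z α β => ginv z α β - mink α β with hH
  change dHLT H (uom y) s₁ s₂ y ≤ 61440 * (tdHnorm H y + tnorm (H y) * dHnorm H y) ∧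
    dtrbar H (uom y) y ≤ 61440 * (tdHnorm H y + tnorm (H y) * dHnorm H y)
  have hsm : tnorm (H y) ≤ 1 / 4 := hsmall y hy
  set G : Fin 4 → Fin 4 → Fin 4 → ℝ := fun γ α β => pd (fun z => H z α β) γ y with hG
  set τ := tdHnorm H y with hτ
  set d := dHnorm H y with hd
  have hτ0 : 0 ≤ τ := Real.sqrt_nonneg _
  have hηd : 0 ≤ tnorm (H y) * d := mul_nonneg (Real.sqrt_nonneg _) (Real.sqrt_nonneg _)
  have hlin := abs_linearized_wave_coordinate_le (g := g y) (h := H y) (G := G) (d := d)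
    (fun α β => by simpa [hH] using hinv y hy α β) hsm (abs_le_sqrt_sum_sq G) (fun ν => by
      simpa [hG, hH, pd_sub_const] using
        sum_pd_eq_of_wave_coordinates hU hsmooth hinv hy (hwave ν y hy))
  have htan : ∀ a α β, |tpd (fun z => H z α β) a y| ≤ τ :=
    abs_le_sqrt_sum_sq fun a α β => tpd (fun z => H z α β) a y
  have hK : ∀ γ α β, |tpd (fun z => H z α β) γ y + uom4 y γ * tpd (fun z => H z α β) 0 y|
      ≤ 2 * τ := fun γ α β => by
    have := abs_mul_le_mul (abs_spat_le_one hω γ) (htan 0 α β)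
    refine (abs_add_le _ _).trans ((add_le_add (htan γ α β) this).trans_eq (by ring))
  have key : ∀ T : Fin 4 → ℝ, (∀ γ, |T γ| ≤ 1) →
      |∑ ν, T ν * (mink ν ν * vecLlow (uom y) ν)| ≤ 2 → ∀ γ,
      |∑ α, ∑ β, (vecLlow (uom y) α * T β
        - 1 / 2 * (∑ ν, T ν * (mink ν ν * vecLlow (uom y) ν)) * mink α β) * G γ α β|
        ≤ 1280 * (τ + tnorm (H y) * d) := fun T hT hlT γ =>
    (abs_contraction_le (fun γ α β => pd_eq_neg_half_vecLlow_mul_add (fun z => H z α β) γ y)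
      (abs_vecLlow_le_one hω) hT hlT hlin hK γ).trans (by linarith)
  constructor
  · have hterm : ∀ (u : Fin 4) (t : Fin 3), |∑ γ, ∑ α, ∑ β,
        Ufam (uom y) s₁ s₂ u γ * vecLlow (uom y) α * TfamLow (uom y) s₁ s₂ t β * G γ α β|
        ≤ (4 : ℕ) * (1 * (1280 * (τ + tnorm (H y) * d))) := by
      intro u t
      refine abs_sum_fin_le fun γ => ?_
      have h0 := sum_TfamLow_mul_vecLlow hF t
      have h := key _ (abs_TfamLow_le_one hω h₁ h₂ t) (by simp [h0]) γ
      rw [h0] at h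
      refine le_of_eq_of_le (congrArg _ ?_) (abs_mul_le_mul (abs_Ufam_le_one hω h₁ h₂ u γ) h)
      simp only [Finset.mul_sum]
      exact Finset.sum_congr rfl fun α _ => Finset.sum_congr rfl fun β _ => by ring
    calc dHLT H (uom y) s₁ s₂ y
        ≤ ∑ _u : Fin 4, ∑ _t : Fin 3, (4 : ℕ) * (1 * (1280 * (τ + tnorm (H y) * d))) :=
          Finset.sum_le_sum fun u _ => Finset.sum_le_sum fun t _ => hterm u t
      _ = 61440 * (τ + tnorm (H y) * d) := by
          simp only [Finset.sum_const, Finset.card_univ, Fintype.card_fin, nsmul_eq_mul]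
          push_cast
          ring
  · have h0 := sum_vecLblow_mul_vecLlow hF.1
    have hterm : ∀ γ, |∑ α, ∑ β, (vecLlow (uom y) α * vecLblow (uom y) β + mink α β) * G γ α β|
        ≤ 1280 * (τ + tnorm (H y) * d) := by
      intro γ
      have h := key _ (abs_vecLblow_le_one hω) (by simp [h0]) γ
      rw [h0] at h
      refine le_of_eq_of_le (congrArg _ ?_) h
      exact Finset.sum_congr rfl fun α _ => Finset.sum_congr rfl fun β _ => by ring
    refine (Real.sqrt_le_sqrt (Finset.sum_le_sum fun γ _ =>
      sq_le_sq' (abs_le.1 (hterm γ)).1 (abs_le.1 (hterm γ)).2)).trans ?_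
    refine Real.sqrt_le_iff.2 ⟨by positivity, ?_⟩
    simp only [Finset.sum_const, Finset.card_univ, Fintype.card_fin, nsmul_eq_mul]
    push_cast
    nlinarith [sq_nonneg (τ + tnorm (H y) * d)]
end LindbladRodnianski
end
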